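/- Let s > 1, 0 < t ≤ 1, and assume λ_2 = 1. Then EXP-(s,t)-WT holds if and only if there exists p ∈ ℕ with γ_p < 1 and lim_{j→∞} (log λ_j⁻¹)^s / log j = ∞, i.e., for every M > 0 one has (log λ_j⁻¹)^s > M·log j for all sufficiently large j (understood to hold at j whenever λ_j = 0). -/

import Mathlib

open Filter Real Set Topology
open scoped ENNReal NNReal

noncomputable section

/-- The weighted eigenvalues `λ_{k,j}`: `1` if `j = 1`, and `γ_k · λ_j` if `j ≥ 2`. -/
def lamKJ (γ lam : ℕ → ℝ) (k j : ℕ) : ℝ := if j = 1 then 1 else γ k * lam j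

/-- The information complexity `n(ε,d)`: the extended-natural cardinality of the set of
`d`-tuples of positive integers `(n_1,…,n_d)` with `λ_{1,n_1} ⋯ λ_{d,n_d} > ε²`. -/
def infoN (γ lam : ℕ → ℝ) (ε : ℝ) (d : ℕ) : ℕ∞ :=
  {n : Fin d → ℕ | (∀ i, 1 ≤ n i) ∧ ε ^ 2 < ∏ i, lamKJ γ lam (i.1 + 1) (n i)}.encard

/-- EXP-SPT with a given exponent `p`: there is `C ≥ 0` with
`n(ε,d) ≤ C (1 + log ε⁻¹)^p` for all `d ≥ 1` and `ε ∈ (0,1]`. -/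
def ExpSPTwith (γ lam : ℕ → ℝ) (p : ℝ) : Prop :=
  ∃ C : ℝ, 0 ≤ C ∧ ∀ d : ℕ, 1 ≤ d → ∀ ε : ℝ, 0 < ε → ε ≤ 1 →
    (infoN γ lam ε d : ℝ≥0∞) ≤ ENNReal.ofReal (C * (1 + Real.log ε⁻¹) ^ p)

/-- Exponential strong polynomial tractability. -/
def ExpSPT (γ lam : ℕ → ℝ) : Prop := ∃ p : ℝ, 0 ≤ p ∧ ExpSPTwith γ lam p

/-- Exponential polynomial tractability: there are `C, q, p ≥ 0` with
`n(ε,d) ≤ C d^q (1 + log ε⁻¹)^p` for all `d ≥ 1` and `ε ∈ (0,1]`. -/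
def ExpPT (γ lam : ℕ → ℝ) : Prop :=
  ∃ C q p : ℝ, 0 ≤ C ∧ 0 ≤ q ∧ 0 ≤ p ∧ ∀ d : ℕ, 1 ≤ d → ∀ ε : ℝ, 0 < ε → ε ≤ 1 →
    (infoN γ lam ε d : ℝ≥0∞) ≤ ENNReal.ofReal (C * (d : ℝ) ^ q * (1 + Real.log ε⁻¹) ^ p)

/-- EXP-QPT with a given exponent `t`. -/
def ExpQPTwith (γ lam : ℕ → ℝ) (t : ℝ) : Prop :=
  ∃ C : ℝ, 0 ≤ C ∧ ∀ d : ℕ, 1 ≤ d → ∀ ε : ℝ, 0 < ε → ε ≤ 1 →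
    (infoN γ lam ε d : ℝ≥0∞) ≤
      ENNReal.ofReal (C * Real.exp (t * (1 + Real.log d) * (1 + Real.log (1 + Real.log ε⁻¹))))

/-- Exponential quasi-polynomial tractability. -/
def ExpQPT (γ lam : ℕ → ℝ) : Prop := ∃ t : ℝ, 0 ≤ t ∧ ExpQPTwith γ lam t

/-- Exponential `(s,t)`-weak tractability:
`log max(1, n(ε,d)) / (d^t + (1 + log ε⁻¹)^s) → 0` as `d + ε⁻¹ → ∞`
(in particular `n(ε,d)` is finite for all such `d, ε`). -/
def ExpSTWT (γ lam : ℕ → ℝ) (s t : ℝ) : Prop :=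
  ∀ δ : ℝ, 0 < δ → ∃ T : ℝ, ∀ d : ℕ, 1 ≤ d → ∀ ε : ℝ, 0 < ε → ε ≤ 1 →
    T ≤ (d : ℝ) + ε⁻¹ →
    ∃ N : ℕ, infoN γ lam ε d = (N : ℕ∞) ∧
      Real.log (max 1 (N : ℝ)) / ((d : ℝ) ^ t + (1 + Real.log ε⁻¹) ^ s) < δ

/-- `j(ε) = max { j ≥ 1 : λ_j > ε² }` (a well-defined maximum when `λ_j → 0`). -/
def jEps (lam : ℕ → ℝ) (ε : ℝ) : ℕ := sSup {j : ℕ | 1 ≤ j ∧ ε ^ 2 < lam j}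

/-- `d(ε) = max { d ≥ 1 : γ_d > ε² }`, with `d(ε) = 0` if `γ_1 ≤ ε²`
(a well-defined maximum when `γ_d → 0`). -/
def dEps (γ : ℕ → ℝ) (ε : ℝ) : ℕ := sSup {d : ℕ | 1 ≤ d ∧ ε ^ 2 < γ d}

/-- The sum of the tuple weights `j ↦ j⁻² d^{-[j ≥ 2]}` in one coordinate is at most `1 + 1/d`. -/
lemma sum_exp_weight_le (d N : ℕ) (hd : 1 ≤ d) :
    ∑ j ∈ Finset.Icc 1 N, Real.exp (-(2 * Real.log j + if 2 ≤ j then Real.log d else 0))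
      ≤ 1 + 1 / (d : ℝ) := by
  have hd0 : (0 : ℝ) < d := by exact_mod_cast hd
  rcases Nat.eq_zero_or_pos N with rfl | hN
  · simp only [Nat.lt_one_iff, Finset.Icc_eq_empty_of_lt, Finset.sum_empty]
    positivity
  rw [← Finset.add_sum_Ioc_eq_sum_Icc (show 1 ≤ N from hN)]
  have h1 : ∀ j ∈ Finset.Ioc 1 N,
      Real.exp (-(2 * Real.log j + if 2 ≤ j then Real.log d else 0))
        = (1 / (d : ℝ)) * ((j : ℝ) ^ 2)⁻¹ := by
    intro j hj
    rw [Finset.mem_Ioc] at hj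
    have hj0 : (0 : ℝ) < j := by exact_mod_cast (by omega : 0 < j)
    rw [if_pos (by omega), Real.exp_neg, Real.exp_add, Real.exp_log hd0,
      show 2 * Real.log j = Real.log ((j : ℝ) ^ 2) by rw [Real.log_pow]; norm_num,
      Real.exp_log (by positivity)]
    field_simp
  rw [Finset.sum_congr rfl h1, ← Finset.mul_sum]
  have h2 : ∑ j ∈ Finset.Ioc 1 N, ((j : ℝ) ^ 2)⁻¹ ≤ 1 := by
    refine (sum_Ioc_inv_sq_le_sub (α := ℝ) one_ne_zero hN).trans ?_
    simp
  have h3 : (1 / (d : ℝ)) * ∑ j ∈ Finset.Ioc 1 N, ((j : ℝ) ^ 2)⁻¹ ≤ 1 / (d : ℝ) :=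
    mul_le_of_le_one_right (by positivity) h2
  simpa using h3

/-- Counting positive integer tuples with bounded product and few entries different from `1`. -/
lemma finite_and_log_ncard_le (d : ℕ) (hd : 1 ≤ d) (A : Set (Fin d → ℕ)) (Q m : ℝ)
    (hQ : 0 ≤ Q) (hm : 0 ≤ m) (hA : ∀ n ∈ A, ∀ i, 1 ≤ n i)
    (hAQ : ∀ n ∈ A, ∑ i, Real.log (n i) ≤ Q)
    (hAm : ∀ n ∈ A, ∑ i, (if 2 ≤ n i then (1 : ℝ) else 0) ≤ m) :
    A.Finite ∧ Real.log (max 1 (A.ncard : ℝ)) ≤ 1 + 2 * Q + m * Real.log d := by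
  have hd0 : (0 : ℝ) < d := by exact_mod_cast hd
  have hlogd : 0 ≤ Real.log d := Real.log_nonneg (by exact_mod_cast hd)
  set N := ⌊Real.exp Q⌋₊
  set box : Finset (Fin d → ℕ) := Fintype.piFinset fun _ => Finset.Icc 1 N
  have hsub : A ⊆ (box : Set (Fin d → ℕ)) := by
    intro n hn
    refine Finset.mem_coe.2 (Fintype.mem_piFinset.2 ?_)
    simp only [Finset.mem_Icc]
    refine fun i => ⟨hA n hn i, Nat.le_floor ?_⟩
    have hi : (0 : ℝ) < n i := by exact_mod_cast hA n hn i
    rw [← Real.log_le_iff_le_exp hi]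
    refine le_trans ?_ (hAQ n hn)
    exact Finset.single_le_sum (f := fun i => Real.log (n i))
      (fun k _ => Real.log_natCast_nonneg _) (Finset.mem_univ i)
  have hfin : A.Finite := box.finite_toSet.subset hsub
  refine ⟨hfin, ?_⟩
  obtain ⟨w, hwdef⟩ : ∃ w : ℕ → ℝ, ∀ j,
      w j = Real.exp (-(2 * Real.log j + if 2 ≤ j then Real.log d else 0)) := ⟨_, fun _ => rfl⟩
  have hw0 : ∀ j, 0 ≤ w j := fun j => (hwdef j).symm ▸ (Real.exp_pos _).le
  have hw : ∀ n ∈ A, Real.exp (-(2 * Q + m * Real.log d)) ≤ ∏ i, w (n i) := by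
    intro n hn
    rw [Finset.prod_congr rfl fun i _ => hwdef (n i), ← Real.exp_sum]
    refine Real.exp_le_exp.2 ?_
    rw [Finset.sum_neg_distrib, Finset.sum_add_distrib, ← Finset.mul_sum]
    have h2 : ∑ i, (if 2 ≤ n i then Real.log d else 0)
        = (∑ i, (if 2 ≤ n i then (1 : ℝ) else 0)) * Real.log d := by
      rw [Finset.sum_mul]
      exact Finset.sum_congr rfl fun i _ => by split_ifs <;> simp
    have h3 := mul_le_mul_of_nonneg_right (hAm n hn) hlogd
    have h4 := hAQ n hn
    rw [h2]
    linarith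
  have hsum : ∑ n ∈ box, ∏ i, w (n i) ≤ Real.exp 1 := by
    have h1 : ∑ n ∈ box, ∏ i, w (n i) = ∏ _i : Fin d, ∑ j ∈ Finset.Icc 1 N, w j :=
      (Finset.prod_univ_sum (fun _ => Finset.Icc 1 N) fun _ j => w j).symm
    rw [h1, Finset.prod_const, Finset.card_univ, Fintype.card_fin]
    have h2 : ∑ j ∈ Finset.Icc 1 N, w j ≤ Real.exp (1 / (d : ℝ)) := by
      rw [Finset.sum_congr rfl fun j _ => hwdef j]
      refine (sum_exp_weight_le d N hd).trans ?_
      have := Real.add_one_le_exp (1 / (d : ℝ))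
      linarith
    refine (pow_le_pow_left₀ (Finset.sum_nonneg fun _ _ => hw0 _) h2 d).trans ?_
    rw [← Real.exp_nat_mul, mul_one_div_cancel hd0.ne']
  have hcard : (A.ncard : ℝ) * Real.exp (-(2 * Q + m * Real.log d)) ≤ Real.exp 1 := by
    rw [Set.ncard_eq_toFinset_card A hfin, ← nsmul_eq_mul]
    refine (Finset.card_nsmul_le_sum _ (fun n => ∏ i, w (n i)) _
      fun n hn => hw n (by simpa using hn)).trans ?_
    refine le_trans (Finset.sum_le_sum_of_subset_of_nonneg ?_ ?_) hsum
    · intro n hn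
      exact hsub (by simpa using hn)
    · exact fun n _ _ => Finset.prod_nonneg fun _ _ => hw0 _
  rw [Real.log_le_iff_le_exp (lt_max_of_lt_left one_pos), max_le_iff]
  constructor
  · rw [Real.one_le_exp_iff]
    positivity
  · rw [Real.exp_neg, ← div_eq_mul_inv, div_le_iff₀ (Real.exp_pos _), ← Real.exp_add] at hcard
    rwa [add_assoc]

/-- `(1 + log d) Y` is dominated by `d^t + Y^s` when `s > 1` and `t > 0`. -/
lemma exists_mul_log_le (s t B η : ℝ) (hs : 1 < s) (ht : 0 < t) (hB : 0 ≤ B) (hη : 0 < η) :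
    ∃ D : ℝ, ∀ d : ℕ, 1 ≤ d → ∀ Y : ℝ, 0 ≤ Y →
      B * (1 + Real.log d) * Y ≤ η * ((d : ℝ) ^ t + Y ^ s) + D := by
  have hpq := Real.HolderConjugate.conjExponent hs
  set q := Real.conjExponent s
  have hq : 1 < q := hpq.symm.lt
  set c : ℝ := η ^ (1 / s)
  have hc : 0 < c := Real.rpow_pos_of_pos hη _
  have hcs : c ^ s = η := by
    simp only [c]
    rw [← Real.rpow_mul hη.le, one_div_mul_cancel (by linarith), Real.rpow_one]
  set u : ℝ := t / (2 * q)
  have hu : 0 < u := by positivity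
  set E : ℝ := (B / c * (1 + 1 / u)) ^ q
  refine ⟨E ^ 2 / η, fun d hd Y hY => ?_⟩
  have hd1 : (1 : ℝ) ≤ d := by exact_mod_cast hd
  have hlogd : 0 ≤ Real.log d := Real.log_nonneg hd1
  have hyoung := Real.young_inequality_of_nonneg (a := c * Y) (b := B / c * (1 + Real.log d))
    (by positivity) (by positivity) hpq
  have e1 : c * Y * (B / c * (1 + Real.log d)) = B * (1 + Real.log d) * Y := by
    field_simp
  rw [e1, Real.mul_rpow hc.le hY, hcs] at hyoung
  have h1 : η * Y ^ s / s ≤ η * Y ^ s := div_le_self (by positivity) hs.le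
  have h2 : (B / c * (1 + Real.log d)) ^ q / q ≤ (B / c * (1 + Real.log d)) ^ q :=
    div_le_self (by positivity) hq.le
  have h3 : 1 + Real.log d ≤ (1 + 1 / u) * (d : ℝ) ^ u := by
    have a1 := Real.log_le_rpow_div (by linarith : (0 : ℝ) ≤ d) hu
    have a2 := Real.one_le_rpow hd1 hu.le
    have : (1 + 1 / u) * (d : ℝ) ^ u = (d : ℝ) ^ u + (d : ℝ) ^ u / u := by ring
    linarith
  have h4 : (B / c * (1 + Real.log d)) ^ q ≤ E * (d : ℝ) ^ (t / 2) := by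
    have : (d : ℝ) ^ (t / 2) = ((d : ℝ) ^ u) ^ q := by
      rw [← Real.rpow_mul (by linarith)]
      congr 1
      simp only [u]
      field_simp
    rw [this, ← Real.mul_rpow (by positivity) (by positivity), mul_assoc]
    refine Real.rpow_le_rpow (by positivity) ?_ (by linarith)
    exact mul_le_mul_of_nonneg_left h3 (by positivity)
  have h5 : (d : ℝ) ^ t = ((d : ℝ) ^ (t / 2)) ^ 2 := by
    rw [← Real.rpow_natCast, ← Real.rpow_mul (by linarith)]
    congr 1
    push_cast
    ring
  have h6 : E * (d : ℝ) ^ (t / 2) ≤ η * ((d : ℝ) ^ (t / 2)) ^ 2 + E ^ 2 / η := by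
    set z := (d : ℝ) ^ (t / 2)
    have e : η * z ^ 2 + E ^ 2 / η - E * z = ((η * z - E / 2) ^ 2 + 3 / 4 * E ^ 2) / η := by
      field_simp
      ring
    have : 0 ≤ η * z ^ 2 + E ^ 2 / η - E * z := by
      rw [e]
      positivity
    linarith
  rw [h5, mul_add]
  linarith

/-- `d^t + (1 + log ε⁻¹)^s` tends to infinity with `d + ε⁻¹`. -/
lemma exists_le_rpow_add_rpow (s t R : ℝ) (hs : 1 < s) (ht : 0 < t) :
    ∃ T : ℝ, ∀ d : ℕ, 1 ≤ d → ∀ ε : ℝ, 0 < ε → ε ≤ 1 → T ≤ (d : ℝ) + ε⁻¹ →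
      R ≤ (d : ℝ) ^ t + (1 + Real.log ε⁻¹) ^ s := by
  refine ⟨|R| ^ (1 / t) + Real.exp R, fun d hd ε hε hε1 hT => ?_⟩
  have hl : 0 ≤ Real.log ε⁻¹ := Real.log_nonneg ((one_le_inv₀ hε).2 hε1)
  have hY : 1 + Real.log ε⁻¹ ≤ (1 + Real.log ε⁻¹) ^ s :=
    Real.self_le_rpow_of_one_le (by linarith) hs.le
  have hd0 : 0 ≤ (d : ℝ) ^ t := by positivity
  rcases le_or_gt (|R| ^ (1 / t)) d with h | h
  · have := Real.rpow_le_rpow (by positivity) h ht.le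
    rw [← Real.rpow_mul (abs_nonneg R), one_div_mul_cancel ht.ne', Real.rpow_one] at this
    linarith [le_abs_self R]
  · have h1 : Real.exp R ≤ ε⁻¹ := by linarith
    have := (Real.le_log_iff_exp_le (inv_pos.2 hε)).2 h1
    linarith

/-- A logarithmic growth bound holding for all indices rather than eventually. -/
lemma exists_log_le_of_eventually (lam : ℕ → ℝ) (s δ : ℝ) (hδ : 0 < δ)
    (hlam_le : ∀ j, 1 ≤ j → lam j ≤ 1)
    (h : ∀ᶠ j : ℕ in atTop, lam j = 0 ∨ δ⁻¹ * Real.log j < Real.log ((lam j)⁻¹) ^ s) :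
    ∃ C : ℝ, 0 ≤ C ∧ ∀ j : ℕ, 1 ≤ j → 0 < lam j →
      Real.log j ≤ δ * (-Real.log (lam j)) ^ s + C * (if 2 ≤ j then 1 else 0) := by
  obtain ⟨J, hJ⟩ := eventually_atTop.1 h
  refine ⟨Real.log J, Real.log_natCast_nonneg _, fun j hj hpos => ?_⟩
  have hL : 0 ≤ -Real.log (lam j) := by
    have := Real.log_nonpos hpos.le (hlam_le j hj)
    linarith
  have hLs : 0 ≤ δ * (-Real.log (lam j)) ^ s := by positivity
  rcases le_or_gt J j with hc | hc
  · have h1 := (hJ j hc).resolve_left hpos.ne'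
    rw [Real.log_inv, inv_mul_lt_iff₀ hδ] at h1
    have : 0 ≤ Real.log J * (if 2 ≤ j then (1 : ℝ) else 0) :=
      mul_nonneg (Real.log_natCast_nonneg _) (by split_ifs <;> norm_num)
    linarith
  · split_ifs with h2
    · have : Real.log j ≤ Real.log J :=
        Real.log_le_log (by exact_mod_cast hj) (by exact_mod_cast hc.le)
      linarith
    · have : j = 1 := by omega
      subst this
      simpa using hLs

/-- Superadditivity of `x ↦ x^s` on nonnegative reals, for finite sums. -/
lemma sum_rpow_le_rpow_of_sum_le {ι : Type*} [Fintype ι] (L : ι → ℝ) (X s : ℝ) (hs : 1 < s)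
    (hL : ∀ i, 0 ≤ L i) (hX : ∑ i, L i ≤ X) : ∑ i, L i ^ s ≤ X ^ s := by
  have hX0 : 0 ≤ X := (Finset.sum_nonneg fun i _ => hL i).trans hX
  have key : ∀ x : ℝ, 0 ≤ x → x ^ s = x * x ^ (s - 1) := fun x hx => by
    rw [← Real.rpow_one_add' hx (by linarith)]
    congr 1
    ring
  calc ∑ i, L i ^ s ≤ ∑ i, L i * X ^ (s - 1) := by
        refine Finset.sum_le_sum fun i _ => ?_
        rw [key _ (hL i)]
        refine mul_le_mul_of_nonneg_left (Real.rpow_le_rpow (hL i) ?_ (by linarith)) (hL i)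
        exact (Finset.single_le_sum (fun k _ => hL k) (Finset.mem_univ i)).trans hX
    _ = (∑ i, L i) * X ^ (s - 1) := by rw [Finset.sum_mul]
    _ ≤ X * X ^ (s - 1) := mul_le_mul_of_nonneg_right hX (by positivity)
    _ = X ^ s := (key X hX0).symm

/-- Constraints satisfied by the tuples counted in the information complexity. -/
lemma sum_neg_log_le_of_lt_prod (γ lam : ℕ → ℝ) (hlam1 : lam 1 = 1)
    (hlam_le : ∀ j, 1 ≤ j → lam j ≤ 1) (hlam_nonneg : ∀ j, 1 ≤ j → 0 ≤ lam j)
    (hγ_anti : AntitoneOn γ (Set.Ici 1))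
    (hγ_pos : ∀ j, 1 ≤ j → 0 < γ j) (hγ_le : ∀ j, 1 ≤ j → γ j ≤ 1)
    (p : ℕ) (hp : 1 ≤ p) (hγp : γ p < 1) (d : ℕ) (ε : ℝ) (hε : 0 < ε)
    (n : Fin d → ℕ) (hn : ∀ i, 1 ≤ n i)
    (hprod : ε ^ 2 < ∏ i, lamKJ γ lam (i.1 + 1) (n i)) :
    (∀ i, 0 < lam (n i)) ∧ ∑ i, -Real.log (lam (n i)) ≤ 2 * Real.log ε⁻¹ ∧
      ∑ i, (if 2 ≤ n i then (1 : ℝ) else 0) ≤ p + 2 * Real.log ε⁻¹ / (-Real.log (γ p)) := by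
  have hne : ∀ i, lamKJ γ lam (i.1 + 1) (n i) ≠ 0 := fun i hi => by
    rw [Finset.prod_eq_zero (Finset.mem_univ i) hi] at hprod
    exact (sq_nonneg ε).not_gt hprod
  have hpos : ∀ i, 0 < lam (n i) := fun i => by
    refine lt_of_le_of_ne (hlam_nonneg _ (hn i)) fun h0 => hne i ?_
    have h1 : n i ≠ 1 := fun h1 => by rw [h1, hlam1] at h0; norm_num at h0
    rw [lamKJ, if_neg h1, ← h0, mul_zero]
  have ha : 0 < -Real.log (γ p) := by
    have := Real.log_neg (hγ_pos p hp) hγp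
    linarith
  have hsum : ∑ i, -Real.log (lamKJ γ lam (i.1 + 1) (n i)) ≤ 2 * Real.log ε⁻¹ := by
    rw [Finset.sum_neg_distrib, ← Real.log_prod fun i _ => hne i, Real.log_inv]
    have := Real.log_le_log (by positivity) hprod.le
    rw [Real.log_pow] at this
    push_cast at this
    linarith
  have hlog : ∀ i, -Real.log (lamKJ γ lam (i.1 + 1) (n i))
      = (if 2 ≤ n i then -Real.log (γ (i.1 + 1)) else 0) + -Real.log (lam (n i)) := fun i => by
    by_cases h1 : n i = 1
    · simp [lamKJ, h1, hlam1]
    · have := hn i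
      rw [lamKJ, if_neg h1, if_pos (by omega),
        Real.log_mul (hγ_pos _ (by omega)).ne' (hpos i).ne']
      ring
  have hγl : ∀ i : Fin d, 0 ≤ -Real.log (γ (i.1 + 1)) := fun i => by
    have := Real.log_nonpos (hγ_pos (i.1 + 1) (by omega)).le (hγ_le _ (by omega))
    linarith
  have hL : ∀ i, 0 ≤ -Real.log (lam (n i)) := fun i => by
    have := Real.log_nonpos (hpos i).le (hlam_le _ (hn i))
    linarith
  refine ⟨hpos, le_trans (Finset.sum_le_sum fun i _ => ?_) hsum, ?_⟩
  · rw [hlog i]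
    have := hγl i
    split_ifs <;> linarith
  · set a := -Real.log (γ p)
    have hterm : ∀ i : Fin d, (if 2 ≤ n i then (1 : ℝ) else 0)
        ≤ (if i.1 < p then 1 else 0) + -Real.log (lamKJ γ lam (i.1 + 1) (n i)) / a := fun i => by
      have hq : 0 ≤ -Real.log (lamKJ γ lam (i.1 + 1) (n i)) / a := by
        refine div_nonneg ?_ ha.le
        rw [hlog i]
        have h1 := hγl i
        have h2 := hL i
        split_ifs <;> linarith
      by_cases h2 : 2 ≤ n i
      · by_cases hi : i.1 < p
        · rw [if_pos h2, if_pos hi]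
          linarith
        · rw [if_pos h2, if_neg hi, zero_add, le_div_iff₀ ha, one_mul, hlog i, if_pos h2]
          have h3 := Real.log_le_log (hγ_pos (i.1 + 1) (by omega))
            (hγ_anti (show p ∈ Set.Ici 1 from hp)
              (show i.1 + 1 ∈ Set.Ici 1 from Nat.le_add_left 1 i.1) (by omega))
          have h4 := hL i
          simp only [a]
          linarith
      · rw [if_neg h2]
        split_ifs <;> linarith
    refine (Finset.sum_le_sum fun i _ => hterm i).trans ?_
    rw [Finset.sum_add_distrib, ← Finset.sum_div]
    refine add_le_add ?_ (div_le_div_of_nonneg_right hsum ha.le)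
    rw [Fin.sum_univ_eq_sum_range (fun i => if i < p then (1 : ℝ) else 0) d, Finset.sum_boole]
    have : (Finset.filter (fun i => i < p) (Finset.range d)).card ≤ p := by
      conv_rhs => rw [← Finset.card_range p]
      exact Finset.card_le_card fun i hi => by
        simpa using (Finset.mem_filter.1 hi).2
    exact_mod_cast this

/-- Sufficiency of the two conditions. -/
lemma expSTWT_of_growth (γ lam : ℕ → ℝ) (hlam1 : lam 1 = 1)
    (hlam_le : ∀ j, 1 ≤ j → lam j ≤ 1) (hlam_nonneg : ∀ j, 1 ≤ j → 0 ≤ lam j)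
    (hγ_anti : AntitoneOn γ (Set.Ici 1))
    (hγ_pos : ∀ j, 1 ≤ j → 0 < γ j) (hγ_le : ∀ j, 1 ≤ j → γ j ≤ 1)
    (s t : ℝ) (hs : 1 < s) (ht0 : 0 < t)
    (hp : ∃ p : ℕ, 1 ≤ p ∧ γ p < 1)
    (hgrowth : ∀ M : ℝ, 0 < M → ∀ᶠ j : ℕ in atTop,
      lam j = 0 ∨ M * Real.log j < Real.log ((lam j)⁻¹) ^ s) :
    ExpSTWT γ lam s t := by
  intro δ₀ hδ₀
  obtain ⟨p, hp1, hγp⟩ := hp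
  have h2s : (0 : ℝ) < 2 ^ s := by positivity
  set δ : ℝ := δ₀ / (8 * 2 ^ s)
  have hδ : 0 < δ := by positivity
  obtain ⟨C, hC, hlogC⟩ := exists_log_le_of_eventually lam s δ hδ hlam_le
    (hgrowth δ⁻¹ (inv_pos.2 hδ))
  have ha : 0 < -Real.log (γ p) := by
    have := Real.log_neg (hγ_pos p hp1) hγp
    linarith
  set a := -Real.log (γ p)
  set B : ℝ := p + 2 / a
  have hB : 0 ≤ B := by positivity
  obtain ⟨D, hD⟩ := exists_mul_log_le s t ((2 * C + 1) * B) (δ₀ / 4) hs ht0 (by positivity)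
    (by positivity)
  obtain ⟨T, hT⟩ := exists_le_rpow_add_rpow s t ((1 + |D|) / (δ₀ / 4)) hs ht0
  refine ⟨T, fun d hd ε hε hε1 hTd => ?_⟩
  have hR := hT d hd ε hε hε1 hTd
  have hl : 0 ≤ Real.log ε⁻¹ := Real.log_nonneg ((one_le_inv₀ hε).2 hε1)
  have hDY := hD d hd (1 + Real.log ε⁻¹) (by linarith)
  set l := Real.log ε⁻¹
  set X := 2 * l
  have hX : 0 ≤ X := by positivity
  set m : ℝ := p + X / a
  have hm : 0 ≤ m := by positivity
  set A : Set (Fin d → ℕ) :=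
    {n | (∀ i, 1 ≤ n i) ∧ ε ^ 2 < ∏ i, lamKJ γ lam (i.1 + 1) (n i)}
  have hfacts := fun n (hn : n ∈ A) =>
    sum_neg_log_le_of_lt_prod γ lam hlam1 hlam_le hlam_nonneg hγ_anti hγ_pos hγ_le p hp1 hγp d ε hε
      n hn.1 hn.2
  obtain ⟨hfin, hcard⟩ := finite_and_log_ncard_le d hd A (δ * X ^ s + C * m) m (by positivity) hm
    (fun n hn => hn.1)
    (by
      intro n hn
      obtain ⟨hpos, hsum, hsupp⟩ := hfacts n hn
      refine (Finset.sum_le_sum fun i _ => hlogC (n i) (hn.1 i) (hpos i)).trans ?_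
      rw [Finset.sum_add_distrib, ← Finset.mul_sum, ← Finset.mul_sum]
      refine add_le_add (mul_le_mul_of_nonneg_left ?_ hδ.le) (mul_le_mul_of_nonneg_left hsupp hC)
      refine sum_rpow_le_rpow_of_sum_le _ X s hs (fun i => ?_) hsum
      have := Real.log_nonpos (hpos i).le (hlam_le _ (hn.1 i))
      linarith)
    (fun n hn => (hfacts n hn).2.2)
  refine ⟨A.ncard, hfin.cast_ncard_eq.symm, ?_⟩
  have hd1 : (1 : ℝ) ≤ d := by exact_mod_cast hd
  have hlogd : 0 ≤ Real.log d := Real.log_nonneg hd1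
  have hdt : 0 < (d : ℝ) ^ t := Real.rpow_pos_of_pos (by linarith) _
  have hYs : 0 < (1 + l) ^ s := Real.rpow_pos_of_pos (by linarith) _
  have hXs : δ * X ^ s ≤ δ₀ / 8 * (1 + l) ^ s := by
    have h1 : X ^ s ≤ 2 ^ s * (1 + l) ^ s := by
      rw [← Real.mul_rpow (by norm_num) (by linarith)]
      exact Real.rpow_le_rpow hX (by simp only [X]; linarith) (by linarith)
    refine (mul_le_mul_of_nonneg_left h1 hδ.le).trans_eq ?_
    simp only [δ]
    field_simp
  have hmB : m ≤ B * (1 + l) := by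
    have h1 : B * (1 + l) = m + (p * l + 2 / a) := by
      simp only [B, m, X]
      ring
    have : 0 ≤ p * l + 2 / a := by positivity
    linarith
  have hlin : 2 * C * m + m * Real.log d ≤ (2 * C + 1) * B * (1 + Real.log d) * (1 + l) := by
    have h1 : 2 * C * m + m * Real.log d = (2 * C + Real.log d) * m := by ring
    have h2 : 2 * C + Real.log d ≤ (2 * C + 1) * (1 + Real.log d) := by nlinarith
    rw [h1]
    refine (mul_le_mul h2 hmB hm (by positivity)).trans_eq (by ring)
  rw [div_le_iff₀ (by positivity)] at hR
  rw [div_lt_iff₀ (by positivity)]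
  have := le_abs_self D
  nlinarith

lemma exists_gamma_lt_one (γ lam : ℕ → ℝ) (hγ_le : ∀ j, 1 ≤ j → γ j ≤ 1)
    (s t : ℝ) (ht1 : t ≤ 1) (hlam2eq : lam 2 = 1)
    (h : ExpSTWT γ lam s t) : ∃ p : ℕ, 1 ≤ p ∧ γ p < 1 := by
  by_contra! hcon
  have hγ : ∀ j, 1 ≤ j → γ j = 1 := fun j hj => le_antisymm (hγ_le j hj) (hcon j hj)
  have hlog2 : 0 < Real.log 2 := Real.log_pos (by norm_num)
  obtain ⟨T, hT⟩ := h (Real.log 2 / 2) (by positivity)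
  set K : ℝ := (1 + Real.log ((1 / 2 : ℝ)⁻¹)) ^ s
  obtain ⟨d, hd⟩ := exists_nat_ge (max 1 (max T K))
  have hd1 : (1 : ℝ) ≤ d := (le_max_left _ _).trans hd
  have hdT : T ≤ d := ((le_max_left _ _).trans (le_max_right _ _)).trans hd
  have hdK : K ≤ d := ((le_max_right _ _).trans (le_max_right _ _)).trans hd
  obtain ⟨N, hN, hlt⟩ := hT d (by exact_mod_cast hd1) (1 / 2) (by norm_num) (by norm_num)
    (by norm_num; linarith)
  have hcube : ((Fintype.piFinset fun _ : Fin d => Finset.Icc 1 2 : Finset (Fin d → ℕ)) :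
      Set (Fin d → ℕ)).encard ≤ infoN γ lam (1 / 2) d := by
    refine Set.encard_le_encard fun n hn => ?_
    simp only [Finset.mem_coe, Fintype.mem_piFinset, Finset.mem_Icc] at hn
    refine ⟨fun i => (hn i).1, ?_⟩
    rw [Finset.prod_eq_one fun i _ => ?_]
    · norm_num
    · rw [lamKJ]
      split_ifs with h1
      · rfl
      · rw [show n i = 2 by have := hn i; omega, hlam2eq, hγ _ (by omega), one_mul]
  rw [Set.encard_coe_eq_coe_finsetCard, hN, Fintype.card_piFinset_const] at hcube
  have hNle : (2 : ℝ) ^ d ≤ N := by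
    have : 2 ^ d ≤ N := by simpa using (by exact_mod_cast hcube : (Finset.Icc 1 2).card ^ _ ≤ N)
    exact_mod_cast this
  have h1 : d * Real.log 2 ≤ Real.log (max 1 (N : ℝ)) := by
    rw [← Real.log_pow]
    exact Real.log_le_log (by positivity) (hNle.trans (le_max_right _ _))
  have hK : 0 < K := Real.rpow_pos_of_pos
    (by have := Real.log_pos (show (1 : ℝ) < (1 / 2)⁻¹ by norm_num); linarith) _
  have hdt : (d : ℝ) ^ t ≤ d := by
    simpa using Real.rpow_le_rpow_of_exponent_le hd1 ht1
  rw [div_lt_iff₀ (by positivity)] at hlt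
  have h2 : Real.log 2 / 2 * ((d : ℝ) ^ t + K) ≤ Real.log 2 / 2 * (d + d) :=
    mul_le_mul_of_nonneg_left (add_le_add hdt hdK) (by positivity)
  have h3 := h1.trans_lt (hlt.trans_le h2)
  linarith

/-- The one-dimensional problem: `ε² < γ₁ λ_j` forces `n(ε,1) ≥ j`. -/
lemma natCast_le_infoN_one (γ lam : ℕ → ℝ) (hlam_anti : AntitoneOn lam (Set.Ici 1))
    (hγ1 : 0 < γ 1) (j : ℕ) (ε : ℝ) (hε : 0 ≤ ε) (hε1 : ε < 1) (h : ε ^ 2 < γ 1 * lam j) :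
    (j : ℕ∞) ≤ infoN γ lam ε 1 := by
  have hinj : Function.Injective fun (k : ℕ) (_ : Fin 1) => k := fun a b hab => congrFun hab 0
  have : (j : ℕ∞) =
      (Set.image (fun (k : ℕ) (_ : Fin 1) => k) (Finset.Icc 1 j : Set ℕ)).encard := by
    rw [hinj.encard_image, Set.encard_coe_eq_coe_finsetCard, Nat.card_Icc, Nat.add_sub_cancel]
  rw [this]
  refine Set.encard_le_encard ?_
  rintro _ ⟨k, hk, rfl⟩
  simp only [Finset.coe_Icc, Set.mem_Icc] at hk
  refine ⟨fun _ => hk.1, ?_⟩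
  simp only [Fin.prod_univ_one, Fin.val_zero, zero_add, lamKJ]
  split_ifs with h1
  · nlinarith
  · have h2 : lam j ≤ lam k := hlam_anti (show k ∈ Set.Ici 1 from hk.1)
      (show j ∈ Set.Ici 1 from hk.1.trans hk.2) hk.2
    exact h.trans_le (mul_le_mul_of_nonneg_left h2 hγ1.le)

lemma eventually_lam_lt (γ lam : ℕ → ℝ) (hlam_anti : AntitoneOn lam (Set.Ici 1))
    (hγ1 : 0 < γ 1) (s t : ℝ) (h : ExpSTWT γ lam s t) (b : ℝ) (hb : 0 < b) :
    ∀ᶠ j : ℕ in atTop, lam j < b := by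
  obtain ⟨T, hT⟩ := h 1 one_pos
  set ε : ℝ := min (1 / 2) (min (max T 1)⁻¹ (min (γ 1 * b) 1))
  have hT1 : 0 < (max T 1)⁻¹ := inv_pos.2 (lt_max_of_lt_right one_pos)
  have hε : 0 < ε := by
    refine lt_min (by norm_num) (lt_min hT1 (lt_min (by positivity) one_pos))
  have hε2 : ε ≤ 1 / 2 := min_le_left _ _
  have hεT : ε ≤ (max T 1)⁻¹ := (min_le_right _ _).trans (min_le_left _ _)
  have hεb : ε ≤ γ 1 * b :=
    (min_le_right _ _).trans ((min_le_right _ _).trans (min_le_left _ _))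
  have hinv : T ≤ ε⁻¹ := by
    rw [le_inv_comm₀ hε (lt_max_of_lt_right one_pos)] at hεT
    exact (le_max_left _ _).trans hεT
  obtain ⟨N, hN, -⟩ := hT 1 le_rfl ε hε (by linarith) (by push_cast; linarith)
  filter_upwards [eventually_gt_atTop N] with j hj
  by_contra! hcon
  have h1 : ε ^ 2 < γ 1 * lam j := by
    have := mul_le_mul_of_nonneg_left hcon hγ1.le
    nlinarith
  have h2 := natCast_le_infoN_one γ lam hlam_anti hγ1 j ε hε.le (by linarith) h1
  rw [hN, Nat.cast_le] at h2
  omega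

lemma growth_of_expSTWT (γ lam : ℕ → ℝ) (hlam_anti : AntitoneOn lam (Set.Ici 1))
    (hlam_nonneg : ∀ j, 1 ≤ j → 0 ≤ lam j)
    (hγ1 : 0 < γ 1) (hγ1_le : γ 1 ≤ 1) (s t : ℝ) (hs : 1 < s) (h : ExpSTWT γ lam s t)
    (M : ℝ) (hM : 0 < M) :
    ∀ᶠ j : ℕ in atTop, lam j = 0 ∨ M * Real.log j < Real.log ((lam j)⁻¹) ^ s := by
  obtain ⟨T, hT⟩ := h (1 / (2 * M)) (by positivity)
  set c : ℝ := -Real.log (γ 1 / 4)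
  have hc : 0 < c := by
    have := Real.log_neg (show 0 < γ 1 / 4 by positivity) (by linarith)
    linarith
  set R : ℝ := max (2 + c) T
  filter_upwards [eventually_lam_lt γ lam hlam_anti hγ1 s t h (Real.exp (-(2 * R))) (Real.exp_pos _),
    eventually_ge_atTop 1] with j hjR hj1
  rcases (hlam_nonneg j hj1).eq_or_lt with h0 | hpos
  · exact Or.inl h0.symm
  right
  rw [Real.log_inv]
  have hL : 2 * R < -Real.log (lam j) := by
    rw [← Real.log_lt_iff_lt_exp hpos] at hjR
    linarith
  set L := -Real.log (lam j)
  have hR1 : 2 + c ≤ R := le_max_left _ _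
  have hR2 : T ≤ R := le_max_right _ _
  -- choose `ε² = γ₁ λ_j / 4`
  set l : ℝ := (L + c) / 2
  set ε : ℝ := Real.exp (-l)
  have hl : 0 < l := by simp only [l]; linarith
  have hε : 0 < ε := Real.exp_pos _
  have hε1 : ε < 1 := Real.exp_lt_one_iff.2 (by linarith)
  have hsq : ε ^ 2 = γ 1 * lam j / 4 := by
    simp only [ε, l, L, c]
    rw [← Real.exp_nat_mul,
      show ((2 : ℕ) : ℝ) * -((-Real.log (lam j) + -Real.log (γ 1 / 4)) / 2)
        = Real.log (lam j) + Real.log (γ 1 / 4) by push_cast; ring,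
      Real.exp_add, Real.exp_log hpos, Real.exp_log (by positivity)]
    ring
  have hlog : Real.log ε⁻¹ = l := by simp [ε]
  have hεinv : T ≤ ε⁻¹ := by
    have h1 : ε⁻¹ = Real.exp l := by simp only [ε]; rw [Real.exp_neg, inv_inv]
    have h2 := Real.add_one_le_exp l
    have h3 : R ≤ l := by simp only [l]; linarith
    rw [h1]
    linarith
  obtain ⟨N, hN, hlt⟩ := hT 1 le_rfl ε hε hε1.le (by push_cast; linarith)
  have hjN := natCast_le_infoN_one γ lam hlam_anti hγ1 j ε hε.le hε1
    (by rw [hsq]; have := mul_pos hγ1 hpos; linarith)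
  rw [hN, Nat.cast_le] at hjN
  have hlogj : Real.log j ≤ Real.log (max 1 (N : ℝ)) := by
    refine Real.log_le_log (by exact_mod_cast hj1) (le_trans ?_ (le_max_right _ _))
    exact_mod_cast hjN
  have hY : 0 < (1 + l) ^ s := Real.rpow_pos_of_pos (by linarith) _
  rw [hlog, div_lt_iff₀ (by positivity), Nat.cast_one, Real.one_rpow] at hlt
  have h1 : (1 : ℝ) ≤ L ^ s := Real.one_le_rpow (by linarith) (by linarith)
  have h2 : (1 + l) ^ s ≤ L ^ s :=
    Real.rpow_le_rpow (by linarith) (by simp only [l]; linarith) (by linarith)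
  have h3 : Real.log j < 1 / (2 * M) * (1 + (1 + l) ^ s) := hlogj.trans_lt hlt
  have h4 := mul_lt_mul_of_pos_left h3 hM
  have h5 : M * (1 / (2 * M) * (1 + (1 + l) ^ s)) = (1 + (1 + l) ^ s) / 2 := by
    field_simp
  linarith

/-- for s > 1, 0 < t ≤ 1 and λ_2 = 1, EXP-(s,t)-WT holds iff there is
p ∈ ℕ with γ_p < 1 and (log λ_j⁻¹)^s / log j → ∞ (understood to hold at j whenever
λ_j = 0). -/
theorem stmt7 (γ lam : ℕ → ℝ)
    (hlam_anti : AntitoneOn lam (Set.Ici 1)) (hlam1 : lam 1 = 1) (hlam2 : 0 < lam 2)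
    (hlam_nonneg : ∀ j, 1 ≤ j → 0 ≤ lam j)
    (hγ_anti : AntitoneOn γ (Set.Ici 1))
    (hγ_pos : ∀ j, 1 ≤ j → 0 < γ j) (hγ_le : ∀ j, 1 ≤ j → γ j ≤ 1)
    (s t : ℝ) (hs : 1 < s) (ht0 : 0 < t) (ht1 : t ≤ 1) (hlam2eq : lam 2 = 1) :
    ExpSTWT γ lam s t ↔
      ((∃ p : ℕ, 1 ≤ p ∧ γ p < 1) ∧
        (∀ M : ℝ, 0 < M → ∀ᶠ j : ℕ in atTop,
          lam j = 0 ∨ M * Real.log j < Real.log ((lam j)⁻¹) ^ s)) := by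
  constructor
  · intro h
    exact ⟨exists_gamma_lt_one γ lam hγ_le s t ht1 hlam2eq h,
      growth_of_expSTWT γ lam hlam_anti hlam_nonneg (hγ_pos 1 le_rfl) (hγ_le 1 le_rfl) s t hs h⟩
  · rintro ⟨hp, hgrowth⟩
    have hlam_le : ∀ j, 1 ≤ j → lam j ≤ 1 := fun j hj =>
      hlam1 ▸ hlam_anti (Set.mem_Ici.2 le_rfl) (Set.mem_Ici.2 hj) hj
    exact expSTWT_of_growth γ lam hlam1 hlam_le hlam_nonneg hγ_anti hγ_pos hγ_le s t hs ht0 hp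
      hgrowth
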